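/- (One-sided equilibrium strategies for the Chichilnisky problem) Suppose u₁′(f(k∞),k∞) > 0, U₁′(f(k∞),k∞) > 0, and f′(k∞) lies strictly between ḡ₀(k∞) and g̲₀(k∞). If g̲₀(k∞) > ḡ₀(k∞), then there exist κ>0 and a function V on (k∞−κ, k∞], C¹ on (k∞−κ, k∞] and C² on its interior, satisfying (f(k)−φ₀(V′(k),k))·V′(k) + u(φ₀(V′(k),k),k) = δ·V(k) on the interval and V(k∞) = (1/δ)·u(f(k∞),k∞), such that the strategy σ(k) := φ₀(V′(k),k) is continuous with σ(k∞) = f(k∞) and, for every k₀ ∈ (k∞−κ, k∞], the solution of dk/dt = f(k) − σ(k), k(0)=k₀, converges to k∞ as t→∞. If g̲₀(k∞) < ḡ₀(k∞), the same conclusion holds with the half-interval [k∞, k∞+κ) in place of (k∞−κ, k∞]. -/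

import Mathlib

open Filter Set

noncomputable def pd1 (u : ℝ → ℝ → ℝ) (c k : ℝ) : ℝ := deriv (fun x => u x k) c
noncomputable def pd2 (u : ℝ → ℝ → ℝ) (c k : ℝ) : ℝ := deriv (fun y => u c y) k
noncomputable def pd11 (u : ℝ → ℝ → ℝ) (c k : ℝ) : ℝ := deriv (fun x => pd1 u x k) c

/-- `ḡ₀(k) = δ − u₂'(f(k),k)/u₁'(f(k),k)`. -/
noncomputable def gbar0 (f : ℝ → ℝ) (u : ℝ → ℝ → ℝ) (δ : ℝ) (k : ℝ) : ℝ :=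
  δ - pd2 u (f k) k / pd1 u (f k) k

/-- `g̲₀(k)` for the Chichilnisky problem. -/
noncomputable def gunder0 (f : ℝ → ℝ) (u U : ℝ → ℝ → ℝ) (δ α : ℝ) (k : ℝ) : ℝ :=
  (1 - α) * δ * pd1 u (f k) k / ((1 - α) * pd1 u (f k) k + α * pd1 U (f k) k) -
  ((1 - α) * pd2 u (f k) k + α * pd2 U (f k) k) /
    ((1 - α) * pd1 u (f k) k + α * pd1 U (f k) k)

/-- A one-sided equilibrium-strategy solution of the limiting HJB problem on the
half-interval `J` limited by `kinf`: a value function `V`, `C¹` up to the endpoint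
(with one-sided derivative `g`), `C²` in the interior, solving
`(f(k)−φ₀(V'(k),k))·V'(k) + u(φ₀(V'(k),k),k) = δ·V(k)` and `V(kinf)=u(f(kinf),kinf)/δ`,
whose strategy `σ = φ₀(V'(·),·)` is continuous, satisfies `σ(kinf)=f(kinf)`, and whose
trajectories starting in `J` converge to `kinf`. -/
def ChiSol (f : ℝ → ℝ) (u : ℝ → ℝ → ℝ) (φ : ℝ → ℝ → ℝ) (δ kinf : ℝ)
    (J : Set ℝ) : Prop :=
  ∃ V g : ℝ → ℝ,
    (∀ k ∈ J, HasDerivWithinAt V (g k) J k) ∧ ContinuousOn g J ∧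
    ContDiffOn ℝ 2 V (interior J) ∧
    (∀ k ∈ J, (f k - φ (g k) k) * g k + u (φ (g k) k) k = δ * V k) ∧
    V kinf = u (f kinf) kinf / δ ∧
    ContinuousOn (fun k => φ (g k) k) J ∧
    φ (g kinf) kinf = f kinf ∧
    ∀ k₀ ∈ J, ∀ K : ℝ → ℝ, K 0 = k₀ →
      (∀ t : ℝ, 0 ≤ t → HasDerivAt K (f (K t) - φ (g (K t)) (K t)) t ∧ K t ∈ J) →
      Tendsto K atTop (nhds kinf)

/-- A forward trajectory of a scalar vector field that is positive on `(a, b)` and nonnegative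
at `b`, confined to `(a, b]`, converges to `b`. -/
lemma tendsto_right_endpoint_of_pos_velocity {v K : ℝ → ℝ} {a b : ℝ}
    (hv : ContinuousOn v (Ioc a b)) (hpos : ∀ x ∈ Ioo a b, 0 < v x) (hb : 0 ≤ v b)
    (hK : ∀ t, 0 ≤ t → HasDerivAt K (v (K t)) t ∧ K t ∈ Ioc a b) :
    Tendsto K atTop (nhds b) := by
  have hcont : ContinuousOn K (Ici 0) := fun t ht =>
    (hK t ht).1.continuousAt.continuousWithinAt
  have hdiff : DifferentiableOn ℝ K (interior (Ici 0)) := fun t ht =>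
    (hK t (interior_subset ht)).1.differentiableAt.differentiableWithinAt
  have hmono : MonotoneOn K (Ici 0) := by
    refine monotoneOn_of_deriv_nonneg (convex_Ici 0) hcont hdiff fun t ht => ?_
    obtain ⟨h1, h2⟩ := hK t (interior_subset ht)
    rw [h1.deriv]
    rcases h2.2.lt_or_eq with h | h
    · exact (hpos _ ⟨h2.1, h⟩).le
    · rwa [h]
  refine tendsto_order.2 ⟨fun y hy => ?_, fun y hy => ?_⟩
  · by_contra hne
    have hle : ∀ t, 0 ≤ t → K t ≤ y := by
      intro t ht
      by_contra! hlt
      refine hne ?_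
      filter_upwards [eventually_ge_atTop t] with r hr
      exact hlt.trans_le (hmono ht (ht.trans hr) hr)
    have h0 := hK 0 le_rfl
    have hsub : Icc (K 0) y ⊆ Ioo a b := fun x hx =>
      ⟨h0.2.1.trans_le hx.1, hx.2.trans_lt hy⟩
    obtain ⟨z, hz, hmin⟩ := isCompact_Icc.exists_isMinOn
      (nonempty_Icc.2 (hle 0 le_rfl)) (hv.mono (hsub.trans Ioo_subset_Ioc_self))
    have hvz : 0 < v z := hpos z (hsub hz)
    have hgrow : ∀ t, 0 ≤ t → v z * t ≤ K t - K 0 := by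
      intro t ht
      have := (convex_Ici (0 : ℝ)).mul_sub_le_image_sub_of_le_deriv hcont hdiff (C := v z)
        (fun r hr => by
          have hr0 : (0 : ℝ) ≤ r := interior_subset hr
          rw [(hK r hr0).1.deriv]
          exact hmin ⟨hmono self_mem_Ici hr0 hr0, hle r hr0⟩) 0 self_mem_Ici t ht ht
      simpa using this
    have hT : 0 ≤ (y - K 0) / v z + 1 :=
      add_nonneg (div_nonneg (sub_nonneg.2 (hle 0 le_rfl)) hvz.le) zero_le_one
    have h1 := hgrow _ hT
    have h2 := hle _ hT
    rw [mul_add, mul_div_cancel₀ _ hvz.ne'] at h1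
    linarith
  · filter_upwards [eventually_ge_atTop 0] with t ht
    exact (hK t ht).2.2.trans_lt hy

/-- A forward trajectory of a scalar vector field that is negative on `(a, b)` and nonpositive
at `a`, confined to `[a, b)`, converges to `a`. -/
lemma tendsto_left_endpoint_of_neg_velocity {v K : ℝ → ℝ} {a b : ℝ}
    (hv : ContinuousOn v (Ico a b)) (hneg : ∀ x ∈ Ioo a b, v x < 0) (ha : v a ≤ 0)
    (hK : ∀ t, 0 ≤ t → HasDerivAt K (v (K t)) t ∧ K t ∈ Ico a b) :
    Tendsto K atTop (nhds a) := by
  have := tendsto_right_endpoint_of_pos_velocity (v := fun x => -v (-x)) (K := fun t => -K t)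
    (a := -b) (b := -a)
    ((hv.comp continuousOn_neg fun x hx => ⟨by linarith [hx.2], by linarith [hx.1]⟩).neg)
    (fun x hx => neg_pos.2 (hneg _ ⟨by linarith [hx.2], by linarith [hx.1]⟩))
    (by simpa using ha)
    (fun t ht => ⟨by simpa using (hK t ht).1.fun_neg,
      by have := (hK t ht).2; exact ⟨neg_lt_neg this.2, neg_le_neg this.1⟩⟩)
  simpa using this.neg

/-- A `C¹` function whose derivative is positive to the right of `0` has a local inverse on
a right half-neighbourhood of its value at `0`, which is `C¹` away from that value. -/
lemma exists_right_inverse_branch {k : ℝ → ℝ} {ε : ℝ} (hε : 0 < ε)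
    (hk : ContDiffOn ℝ 1 k (Ioo (-ε) ε)) (hpos : ∀ s ∈ Ioo 0 ε, 0 < deriv k s) :
    ∃ κ > (0 : ℝ), ∃ S : ℝ → ℝ, S (k 0) = 0 ∧
      (∀ x ∈ Ico (k 0) (k 0 + κ), S x ∈ Ico 0 ε ∧ k (S x) = x) ∧
      ContinuousOn S (Ico (k 0) (k 0 + κ)) ∧
      ContDiffOn ℝ 1 S (Ioo (k 0) (k 0 + κ)) ∧
      ∀ x ∈ Ioo (k 0) (k 0 + κ), S x ∈ Ioo 0 ε ∧ HasDerivAt S (deriv k (S x))⁻¹ x := by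
  set e := ε / 2 with he
  have he0 : 0 < e := half_pos hε
  have heε : e < ε := half_lt_self hε
  have hsub : Icc 0 e ⊆ Ioo (-ε) ε := fun s hs => ⟨by linarith [hs.1], by linarith [hs.2]⟩
  have hcont : ContinuousOn k (Icc 0 e) := hk.continuousOn.mono hsub
  have hmono : StrictMonoOn k (Icc 0 e) := by
    refine strictMonoOn_of_deriv_pos (convex_Icc 0 e) hcont fun s hs => ?_
    rw [interior_Icc] at hs
    exact hpos s ⟨hs.1, hs.2.trans heε⟩
  have h0 : (0 : ℝ) ∈ Icc 0 e := ⟨le_rfl, he0.le⟩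
  have h1 : e ∈ Icc 0 e := ⟨he0.le, le_rfl⟩
  have himage : k '' Icc 0 e = Icc (k 0) (k e) := by
    refine subset_antisymm ?_ (intermediate_value_Icc he0.le hcont)
    rintro _ ⟨s, hs, rfl⟩
    exact ⟨hmono.monotoneOn h0 hs hs.1, hmono.monotoneOn hs h1 hs.2⟩
  set S := Function.invFunOn k (Icc 0 e) with hS
  have hSmem : ∀ x ∈ Icc (k 0) (k e), S x ∈ Icc 0 e := fun x hx =>
    Function.invFunOn_mem (by rwa [← himage] at hx)
  have hkS : ∀ x ∈ Icc (k 0) (k e), k (S x) = x := fun x hx =>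
    Function.invFunOn_eq (by rwa [← himage] at hx)
  have hSk : ∀ s ∈ Icc 0 e, S (k s) = s := fun s hs =>
    hmono.injOn.leftInvOn_invFunOn hs
  have hScont : ContinuousOn S (Icc (k 0) (k e)) := by
    refine continuousOn_iff_isClosed.2 fun t ht => ⟨k '' (Icc 0 e ∩ t), ?_, ?_⟩
    · exact ((isCompact_Icc.inter_right ht).image_of_continuousOn
        (hcont.mono inter_subset_left)).isClosed
    · ext x
      constructor
      · rintro ⟨hx, hx'⟩
        exact ⟨⟨S x, ⟨hSmem x hx', hx⟩, hkS x hx'⟩, hx'⟩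
      · rintro ⟨⟨s, ⟨hs, hst⟩, rfl⟩, hx'⟩
        exact ⟨by rwa [mem_preimage, hSk s hs], hx'⟩
  have hke : k 0 < k e := hmono h0 h1 he0
  have hioo : ∀ x ∈ Ioo (k 0) (k e), S x ∈ Ioo 0 ε := by
    intro x hx
    have hx' := Ioo_subset_Icc_self hx
    refine ⟨(hSmem x hx').1.lt_of_ne ?_, (hSmem x hx').2.trans_lt heε⟩
    intro h
    have := hkS x hx'
    rw [← h] at this
    exact hx.1.ne this
  have hderiv : ∀ x ∈ Ioo (k 0) (k e), HasDerivAt S (deriv k (S x))⁻¹ x := by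
    intro x hx
    have hSx := hioo x hx
    refine HasDerivAt.of_local_left_inverse
      (hScont.continuousAt (Icc_mem_nhds hx.1 hx.2))
      (differentiableAt_of_deriv_ne_zero (hpos _ hSx).ne').hasDerivAt (hpos _ hSx).ne' ?_
    filter_upwards [Icc_mem_nhds hx.1 hx.2] with y hy using hkS y hy
  have hC1 : ContDiffOn ℝ 1 S (Ioo (k 0) (k e)) := by
    rw [show (1 : WithTop ℕ∞) = 0 + 1 by simp, contDiffOn_succ_iff_deriv_of_isOpen isOpen_Ioo]
    refine ⟨fun x hx => (hderiv x hx).differentiableAt.differentiableWithinAt, by simp, ?_⟩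
    rw [contDiffOn_zero]
    have hk' : ContinuousOn (deriv k) (Ioo (-ε) ε) := hk.continuousOn_deriv_of_isOpen isOpen_Ioo le_rfl
    have : ContinuousOn (fun x => (deriv k (S x))⁻¹) (Ioo (k 0) (k e)) :=
      (hk'.comp (hScont.mono Ioo_subset_Icc_self) fun x hx =>
        ⟨by linarith [(hioo x hx).1], (hioo x hx).2⟩).inv₀ fun x hx => (hpos _ (hioo x hx)).ne'
    exact this.congr fun x hx => (hderiv x hx).deriv
  refine ⟨k e - k 0, sub_pos.2 hke, S, hSk 0 h0, ?_⟩
  rw [add_sub_cancel]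
  exact ⟨fun x hx => ⟨⟨(hSmem x (Ico_subset_Icc_self hx)).1,
      (hSmem x (Ico_subset_Icc_self hx)).2.trans_lt heε⟩, hkS x (Ico_subset_Icc_self hx)⟩,
    hScont.mono Ico_subset_Icc_self, hC1, fun x hx => ⟨hioo x hx, hderiv x hx⟩⟩

/-- Mirror image of `exists_right_inverse_branch`: a `C¹` function whose derivative is negative
to the right of `0` has a local inverse on a left half-neighbourhood of its value at `0`. -/
lemma exists_left_inverse_branch {k : ℝ → ℝ} {ε : ℝ} (hε : 0 < ε)
    (hk : ContDiffOn ℝ 1 k (Ioo (-ε) ε)) (hneg : ∀ s ∈ Ioo 0 ε, deriv k s < 0) :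
    ∃ κ > (0 : ℝ), ∃ S : ℝ → ℝ, S (k 0) = 0 ∧
      (∀ x ∈ Ioc (k 0 - κ) (k 0), S x ∈ Ico 0 ε ∧ k (S x) = x) ∧
      ContinuousOn S (Ioc (k 0 - κ) (k 0)) ∧
      ContDiffOn ℝ 1 S (Ioo (k 0 - κ) (k 0)) ∧
      ∀ x ∈ Ioo (k 0 - κ) (k 0), S x ∈ Ioo 0 ε ∧ HasDerivAt S (deriv k (S x))⁻¹ x := by
  have hd : ∀ s, deriv (fun s => -k s) s = -deriv k s := fun s => deriv.fun_neg
  obtain ⟨κ, hκ, S, hS0, hS, hSc, hS1, hSd⟩ :=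
    exists_right_inverse_branch (k := fun s => -k s) hε hk.neg
      (fun s hs => by rw [hd]; exact neg_pos.2 (hneg s hs))
  have hIoc : MapsTo (fun x => -x) (Ioc (k 0 - κ) (k 0)) (Ico (-k 0) (-k 0 + κ)) :=
    fun x hx => ⟨by linarith [hx.2], by linarith [hx.1]⟩
  have hIoo : MapsTo (fun x => -x) (Ioo (k 0 - κ) (k 0)) (Ioo (-k 0) (-k 0 + κ)) :=
    fun x hx => ⟨by linarith [hx.2], by linarith [hx.1]⟩
  refine ⟨κ, hκ, fun x => S (-x), hS0, fun x hx => ?_, hSc.comp continuousOn_neg hIoc,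
    hS1.comp contDiff_neg.contDiffOn hIoo, fun x hx => ?_⟩
  · obtain ⟨h1, h2⟩ := hS _ (hIoc hx)
    exact ⟨h1, neg_injective h2⟩
  · obtain ⟨h1, h2⟩ := hSd _ (hIoo hx)
    refine ⟨h1, ?_⟩
    have := h2.scomp x (hasDerivAt_neg x)
    rw [hd] at this
    simpa [Function.comp_def, inv_neg] using this

lemma hasDerivAt_pd1 {u : ℝ → ℝ → ℝ} {c k : ℝ}
    (h : DifferentiableAt ℝ (fun p : ℝ × ℝ => u p.1 p.2) (c, k)) :
    HasDerivAt (fun x => u x k) (fderiv ℝ (fun p : ℝ × ℝ => u p.1 p.2) (c, k) (1, 0)) c :=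
  HasFDerivAt.comp_hasDerivAt (f := fun x : ℝ => (x, k)) c h.hasFDerivAt
    ((hasDerivAt_id c).prodMk (hasDerivAt_const c k))

lemma hasDerivAt_pd2 {u : ℝ → ℝ → ℝ} {c k : ℝ}
    (h : DifferentiableAt ℝ (fun p : ℝ × ℝ => u p.1 p.2) (c, k)) :
    HasDerivAt (fun y => u c y) (fderiv ℝ (fun p : ℝ × ℝ => u p.1 p.2) (c, k) (0, 1)) k :=
  HasFDerivAt.comp_hasDerivAt (f := fun y : ℝ => (c, y)) k h.hasFDerivAt
    ((hasDerivAt_const k c).prodMk (hasDerivAt_id k))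

lemma contDiffOn_pd1 {u : ℝ → ℝ → ℝ} {Q : Set (ℝ × ℝ)} (hQ : IsOpen Q)
    (h : ContDiffOn ℝ (⊤ : ℕ∞) (fun p : ℝ × ℝ => u p.1 p.2) Q) :
    ContDiffOn ℝ (⊤ : ℕ∞) (fun p : ℝ × ℝ => pd1 u p.1 p.2) Q :=
  ((h.fderiv_of_isOpen hQ (m := (⊤ : ℕ∞)) (by simp)).clm_apply contDiffOn_const).congr
    fun p hp => (hasDerivAt_pd1 ((h.contDiffAt (hQ.mem_nhds hp)).differentiableAt (by simp))).deriv

lemma contDiffOn_pd2 {u : ℝ → ℝ → ℝ} {Q : Set (ℝ × ℝ)} (hQ : IsOpen Q)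
    (h : ContDiffOn ℝ (⊤ : ℕ∞) (fun p : ℝ × ℝ => u p.1 p.2) Q) :
    ContDiffOn ℝ (⊤ : ℕ∞) (fun p : ℝ × ℝ => pd2 u p.1 p.2) Q :=
  ((h.fderiv_of_isOpen hQ (m := (⊤ : ℕ∞)) (by simp)).clm_apply contDiffOn_const).congr
    fun p hp => (hasDerivAt_pd2 ((h.contDiffAt (hQ.mem_nhds hp)).differentiableAt (by simp))).deriv

/-- Chain rule along a curve, in terms of partial derivatives. -/
lemma hasDerivAt_along_curve {H : ℝ → ℝ → ℝ} {c k : ℝ → ℝ} {s c' k' : ℝ}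
    (h : DifferentiableAt ℝ (fun p : ℝ × ℝ => H p.1 p.2) (c s, k s))
    (hc : HasDerivAt c c' s) (hk : HasDerivAt k k' s) :
    HasDerivAt (fun s => H (c s) (k s))
      (pd1 H (c s) (k s) * c' + pd2 H (c s) (k s) * k') s := by
  have h1 : HasDerivAt (fun s => H (c s) (k s))
      (fderiv ℝ (fun p : ℝ × ℝ => H p.1 p.2) (c s, k s) (c', k')) s :=
    HasFDerivAt.comp_hasDerivAt (f := fun s => (c s, k s)) s h.hasFDerivAt (hc.prodMk hk)
  convert h1 using 1
  rw [show (c', k') = c' • ((1 : ℝ), (0 : ℝ)) + k' • ((0 : ℝ), (1 : ℝ)) by simp, map_add,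
    map_smul, map_smul, pd1, pd2, (hasDerivAt_pd1 h).deriv, (hasDerivAt_pd2 h).deriv]
  simp [mul_comm]

/-- Characteristic curves of the implicit equation `δ V = H(c, k)`, `V' = P(c, k)`. -/
lemma exists_characteristic {H P : ℝ → ℝ → ℝ} {Q : Set (ℝ × ℝ)} (hQ : IsOpen Q)
    (hH : ContDiffOn ℝ (⊤ : ℕ∞) (fun p : ℝ × ℝ => H p.1 p.2) Q)
    (hP : ContDiffOn ℝ (⊤ : ℕ∞) (fun p : ℝ × ℝ => P p.1 p.2) Q)
    (δ : ℝ) {c₀ k₀ : ℝ} (h₀ : (c₀, k₀) ∈ Q) :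
    ∃ ε > (0 : ℝ), ∃ c k : ℝ → ℝ, c 0 = c₀ ∧ k 0 = k₀ ∧
      ContDiffOn ℝ 1 c (Ioo (-ε) ε) ∧ ContDiffOn ℝ 1 k (Ioo (-ε) ε) ∧
      ∀ s ∈ Ioo (-ε) ε, (c s, k s) ∈ Q ∧
        HasDerivAt c (δ * P (c s) (k s) - pd2 H (c s) (k s)) s ∧
        HasDerivAt k (pd1 H (c s) (k s)) s ∧
        HasDerivAt (fun s => H (c s) (k s)) (δ * (P (c s) (k s) * pd1 H (c s) (k s))) s := by
  set F : ℝ × ℝ → ℝ × ℝ := fun p => (δ * P p.1 p.2 - pd2 H p.1 p.2, pd1 H p.1 p.2) with hF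
  have hFs : ContDiffOn ℝ (⊤ : ℕ∞) F Q :=
    ((contDiffOn_const.mul hP).sub (contDiffOn_pd2 hQ hH)).prodMk (contDiffOn_pd1 hQ hH)
  obtain ⟨γ, hγ0, ε₁, hε₁, hγ⟩ :=
    ((hFs.contDiffAt (hQ.mem_nhds h₀)).of_le
      (by exact_mod_cast le_top)).exists_forall_mem_closedBall_exists_eq_forall_mem_Ioo_hasDerivAt₀ 0
  simp only [zero_sub, zero_add] at hγ
  have hγc : ContinuousAt γ 0 := (hγ 0 ⟨by linarith, hε₁⟩).continuousAt
  obtain ⟨ε₂, hε₂, hball⟩ := Metric.eventually_nhds_iff.1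
    (hγc.eventually (hQ.mem_nhds (by rwa [hγ0])))
  set ε := min ε₁ ε₂ with hε
  have hεpos : 0 < ε := lt_min hε₁ hε₂
  have hderiv : ∀ s ∈ Ioo (-ε) ε, HasDerivAt γ (F (γ s)) s := fun s hs =>
    hγ s ⟨by linarith [hs.1, min_le_left ε₁ ε₂], hs.2.trans_le (min_le_left _ _)⟩
  have hmem : ∀ s ∈ Ioo (-ε) ε, γ s ∈ Q := fun s hs => hball (by
    rw [Real.dist_eq, sub_zero]
    exact (abs_lt.2 hs).trans_le (min_le_right _ _))
  have hγ1 : ContDiffOn ℝ 1 γ (Ioo (-ε) ε) := by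
    rw [show (1 : WithTop ℕ∞) = 0 + 1 by simp, contDiffOn_succ_iff_deriv_of_isOpen isOpen_Ioo]
    refine ⟨fun x hx => (hderiv x hx).differentiableAt.differentiableWithinAt, by simp, ?_⟩
    rw [contDiffOn_zero]
    exact (hFs.continuousOn.comp (fun s hs => (hderiv s hs).continuousAt.continuousWithinAt)
      hmem).congr fun s hs => (hderiv s hs).deriv
  refine ⟨ε, hεpos, fun s => (γ s).1, fun s => (γ s).2, by simp [hγ0], by simp [hγ0],
    hγ1.fst, hγ1.snd, fun s hs => ?_⟩
  have hc : HasDerivAt (fun s => (γ s).1) (F (γ s)).1 s := (hderiv s hs).fst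
  have hk : HasDerivAt (fun s => (γ s).2) (F (γ s)).2 s := (hderiv s hs).snd
  refine ⟨hmem s hs, hc, hk, ?_⟩
  convert hasDerivAt_along_curve
    ((hH.contDiffAt (hQ.mem_nhds (hmem s hs))).differentiableAt (by simp)) hc hk using 1
  simp only [hF]
  ring

/-- The Hamiltonian `(f(k) - c) u₁'(c, k) + u(c, k)`, with consumption as a coordinate in
place of the costate `u₁'(c, k)`. -/
noncomputable def consumptionHamiltonian (f : ℝ → ℝ) (u : ℝ → ℝ → ℝ) (c k : ℝ) : ℝ :=
  (f k - c) * pd1 u c k + u c k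

lemma pd1_consumptionHamiltonian (f : ℝ → ℝ) {u : ℝ → ℝ → ℝ} {c k : ℝ}
    (hu : DifferentiableAt ℝ (fun p : ℝ × ℝ => u p.1 p.2) (c, k))
    (hu1 : DifferentiableAt ℝ (fun p : ℝ × ℝ => pd1 u p.1 p.2) (c, k)) :
    pd1 (consumptionHamiltonian f u) c k = (f k - c) * pd11 u c k := by
  have h1 : HasDerivAt (fun x => u x k) (pd1 u c k) c :=
    (hasDerivAt_pd1 hu).differentiableAt.hasDerivAt
  have h2 : HasDerivAt (fun x => pd1 u x k) (pd11 u c k) c :=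
    (hasDerivAt_pd1 hu1).differentiableAt.hasDerivAt
  have := ((((hasDerivAt_id c).const_sub (f k)).fun_mul h2).fun_add h1).deriv
  simp only [id_eq] at this
  rw [pd1]
  simp only [consumptionHamiltonian]
  rw [this]
  ring

lemma pd2_consumptionHamiltonian {f : ℝ → ℝ} {u : ℝ → ℝ → ℝ} {k : ℝ}
    (hf : DifferentiableAt ℝ f k)
    (hu : DifferentiableAt ℝ (fun p : ℝ × ℝ => u p.1 p.2) (f k, k))
    (hu1 : DifferentiableAt ℝ (fun p : ℝ × ℝ => pd1 u p.1 p.2) (f k, k)) :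
    pd2 (consumptionHamiltonian f u) (f k) k =
      deriv f k * pd1 u (f k) k + pd2 u (f k) k := by
  have h1 : HasDerivAt (fun y => u (f k) y) (pd2 u (f k) k) k :=
    (hasDerivAt_pd2 hu).differentiableAt.hasDerivAt
  have h2 := hasDerivAt_pd2 hu1
  have := (((hf.hasDerivAt.sub_const (f k)).fun_mul h2).fun_add h1).deriv
  rw [pd2]
  simp only [consumptionHamiltonian]
  rw [this]
  ring

/-- A characteristic curve reparametrised by capital yields a one-sided solution. -/
lemma chiSol_of_branch {f : ℝ → ℝ} {u φ : ℝ → ℝ → ℝ} {δ κ ε kinf : ℝ} {J : Set ℝ}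
    {c k q S : ℝ → ℝ} (hδ : δ ≠ 0) (hκ : 0 < κ) (hε : 0 < ε)
    (hf : ContinuousOn f J)
    (hc : ContDiffOn ℝ 1 c (Ioo (-ε) ε)) (hq : ContDiffOn ℝ 1 q (Ioo (-ε) ε))
    (hφ : ∀ s ∈ Ioo (-ε) ε, φ (q s) (k s) = c s)
    (hc0 : c 0 = f kinf)
    (hW : ∀ s ∈ Ioo (-ε) ε,
      HasDerivAt (fun s => (f (k s) - c s) * q s + u (c s) (k s)) (δ * (q s * deriv k s)) s)
    (hk' : ∀ s ∈ Ioo 0 ε, deriv k s ≠ 0) (hS0 : S kinf = 0)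
    (hS : ∀ x ∈ J, S x ∈ Ico 0 ε ∧ k (S x) = x) (hSc : ContinuousOn S J)
    (hS1 : ContDiffOn ℝ 1 S (interior J))
    (hSd : ∀ x ∈ interior J, S x ∈ Ioo 0 ε ∧ HasDerivAt S (deriv k (S x))⁻¹ x)
    (hsign : J = Ico kinf (kinf + κ) ∧ (∀ s ∈ Ioo 0 ε, f (k s) - c s < 0) ∨
      J = Ioc (kinf - κ) kinf ∧ (∀ s ∈ Ioo 0 ε, 0 < f (k s) - c s)) :
    ChiSol f u φ δ kinf J := by
  have hJ := hsign.imp And.left And.left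
  have hmem : ∀ x ∈ J, S x ∈ Ioo (-ε) ε := fun x hx =>
    ⟨by linarith [(hS x hx).1.1], (hS x hx).1.2⟩
  have hkinf : kinf ∈ J := by
    rcases hJ with rfl | rfl
    · exact ⟨le_rfl, by linarith⟩
    · exact ⟨by linarith, le_rfl⟩
  have hk0 : k 0 = kinf := by simpa [hS0] using (hS kinf hkinf).2
  set V : ℝ → ℝ := fun x =>
    ((f (k (S x)) - c (S x)) * q (S x) + u (c (S x)) (k (S x))) / δ with hV
  set g : ℝ → ℝ := fun x => q (S x) with hg
  have hφg : ∀ x ∈ J, φ (g x) x = c (S x) := by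
    intro x hx
    have := hφ (S x) (hmem x hx)
    rwa [(hS x hx).2] at this
  have hgc : ContinuousOn g J := hq.continuousOn.comp hSc hmem
  have hVc : ContinuousOn V J :=
    (ContinuousOn.comp (t := Ioo (-ε) ε)
      (fun s hs => (hW s hs).continuousAt.continuousWithinAt) hSc hmem).div_const δ
  have hVd : ∀ x ∈ interior J, HasDerivAt V (g x) x := by
    intro x hx
    obtain ⟨h1, h2⟩ := hSd x hx
    have := (HasDerivAt.comp x (hW (S x) ⟨by linarith [h1.1], h1.2⟩) h2).div_const δ
    have hne := hk' _ h1
    refine this.congr_deriv ?_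
    simp only [hg]
    field_simp
  have hintJ : interior J = J \ {kinf} := by
    rcases hJ with rfl | rfl
    · rw [interior_Ico, Ico_sdiff_left]
    · rw [interior_Ioc, Ioc_sdiff_right]
  have hσc : ContinuousOn (fun x => φ (g x) x) J :=
    (hc.continuousOn.comp hSc hmem).congr hφg
  have hσinf : φ (g kinf) kinf = f kinf := by rw [hφg kinf hkinf, hS0, hc0]
  have hvel : ∀ x ∈ J, f x - φ (g x) x = f (k (S x)) - c (S x) := by
    intro x hx
    rw [hφg x hx, (hS x hx).2]
  have hderivV : ∀ x ∈ interior J, deriv V x = g x := fun x hx => (hVd x hx).deriv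
  refine ⟨V, g, ?_, hgc, ?_, ?_, ?_, hσc, hσinf, ?_⟩
  · intro x hx
    by_cases hxk : x = kinf
    · subst hxk
      have hdiff : DifferentiableOn ℝ V (interior J) := fun y hy =>
        (hVd y hy).differentiableAt.differentiableWithinAt
      have hlim : Tendsto (fun y => deriv V y) (nhdsWithin x (interior J)) (nhds (g x)) :=
        ((hgc x hx).mono interior_subset).congr'
          (by filter_upwards [self_mem_nhdsWithin] with y hy using (hderivV y hy).symm)
      have hcw : ContinuousWithinAt V (interior J) x := (hVc x hx).mono interior_subset
      rcases hJ with rfl | rfl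
      · rw [interior_Ico] at *
        have hn : nhdsWithin x (Ioo x (x + κ)) = nhdsWithin x (Ioi x) :=
          nhdsWithin_Ioo_eq_nhdsGT (by linarith)
        rw [hn] at hlim
        exact (hasDerivWithinAt_Ici_of_tendsto_deriv hdiff hcw
          (Ioo_mem_nhdsGT (by linarith)) hlim).mono Ico_subset_Ici_self
      · rw [interior_Ioc] at *
        have hn : nhdsWithin x (Ioo (x - κ) x) = nhdsWithin x (Iio x) :=
          nhdsWithin_Ioo_eq_nhdsLT (by linarith)
        rw [hn] at hlim
        exact (hasDerivWithinAt_Iic_of_tendsto_deriv hdiff hcw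
          (Ioo_mem_nhdsLT (by linarith)) hlim).mono Ioc_subset_Iic_self
    · exact (hVd x (by rw [hintJ]; exact ⟨hx, hxk⟩)).hasDerivWithinAt
  · rw [show (2 : WithTop ℕ∞) = 1 + 1 by norm_num,
      contDiffOn_succ_iff_deriv_of_isOpen isOpen_interior]
    refine ⟨fun y hy => (hVd y hy).differentiableAt.differentiableWithinAt, by simp, ?_⟩
    exact (hq.comp hS1 fun y hy => hmem y (interior_subset hy)).congr hderivV
  · intro x hx
    rw [hvel x hx, hφg x hx]
    simp only [hV, hg]
    rw [mul_div_cancel₀ _ hδ, (hS x hx).2]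
  · simp only [hV, hS0, hk0, hc0, sub_self, zero_mul, zero_add]
  · intro k₀ _ K _ hK
    have hvc : ContinuousOn (fun x => f x - φ (g x) x) J := hf.sub hσc
    have hvinf : f kinf - φ (g kinf) kinf = 0 := by rw [hσinf, sub_self]
    rcases hsign with ⟨rfl, hneg⟩ | ⟨rfl, hpos⟩
    · refine tendsto_left_endpoint_of_neg_velocity hvc (fun x hx => ?_) hvinf.le hK
      rw [hvel x (Ioo_subset_Ico_self hx)]
      exact hneg _ (hSd x (by rwa [interior_Ico])).1
    · refine tendsto_right_endpoint_of_pos_velocity hvc (fun x hx => ?_) hvinf.ge hK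
      rw [hvel x (Ioo_subset_Ioc_self hx)]
      exact hpos _ (hSd x (by rwa [interior_Ioc])).1

lemma eventually_pos_right_of_hasDerivAt {m : ℝ → ℝ} {m' : ℝ} (h : HasDerivAt m m' 0)
    (h0 : m 0 = 0) (hm' : 0 < m') : ∃ ε > (0 : ℝ), ∀ s ∈ Ioo 0 ε, 0 < m s := by
  have hev : ∀ᶠ s in nhdsWithin 0 (Ioi 0), 0 < slope m 0 s :=
    (hasDerivAt_iff_tendsto_slope.1 h).mono_left
      (nhdsWithin_mono _ fun s hs => ne_of_gt hs) |>.eventually (eventually_gt_nhds hm')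
  obtain ⟨ε, hε, hsub⟩ := mem_nhdsGT_iff_exists_Ioo_subset.1 hev
  refine ⟨ε, hε, fun s hs => ?_⟩
  have : 0 < slope m 0 s := hsub hs
  rw [slope_def_field, h0, sub_zero, sub_zero] at this
  exact (div_pos_iff_of_pos_right hs.1).1 this

lemma eq_of_pd1_eq {u : ℝ → ℝ → ℝ} {k : ℝ} (h : ∀ c > (0 : ℝ), pd11 u c k < 0) {c d : ℝ}
    (hc : 0 < c) (hd : 0 < d) (hcd : pd1 u c k = pd1 u d k) : c = d := by
  have hanti : StrictAntiOn (fun x => pd1 u x k) (Ioi 0) :=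
    strictAntiOn_of_deriv_neg (convex_Ioi 0)
      (fun x hx => (differentiableAt_of_deriv_ne_zero
        (h x hx).ne).continuousAt.continuousWithinAt)
      fun x hx => h x (interior_subset hx)
  exact hanti.injOn hc hd hcd

/-- One-sided equilibrium strategies for the Chichilnisky problem.
If `f'(k∞)` lies strictly between `ḡ₀(k∞)` and `g̲₀(k∞)`, then there is a one-sided
equilibrium strategy converging to `k∞`, defined on `(k∞−κ, k∞]` if `g̲₀(k∞) > ḡ₀(k∞)`
and on `[k∞, k∞+κ)` if `g̲₀(k∞) < ḡ₀(k∞)`. -/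
theorem stmt_17
    (f : ℝ → ℝ) (u U : ℝ → ℝ → ℝ) (δ α : ℝ)
    (hδ : 0 < δ) (hα0 : 0 < α) (hα1 : α < 1)
    (hf_conc : ConcaveOn ℝ (Set.Ici 0) f)
    (hf_cont : ContinuousOn f (Set.Ici 0))
    (hf_smooth : ContDiffOn ℝ (⊤ : ℕ∞) f (Set.Ioi 0))
    (hf_inada0 : Tendsto (deriv f) (nhdsWithin 0 (Set.Ioi 0)) atTop)
    (hf_inada1 : ∃ L ≤ (0:ℝ), Tendsto (deriv f) atTop (nhds L))
    (hu_smooth : ContDiffOn ℝ (⊤ : ℕ∞) (fun p : ℝ × ℝ => u p.1 p.2) (Set.Ioi 0 ×ˢ Set.Ioi 0))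
    (hU_smooth : ContDiffOn ℝ (⊤ : ℕ∞) (fun p : ℝ × ℝ => U p.1 p.2) (Set.Ioi 0 ×ˢ Set.Ioi 0))
    (hu_mono : ∀ k > (0:ℝ), StrictMonoOn (fun c => u c k) (Set.Ioi 0))
    (hU_mono : ∀ k > (0:ℝ), StrictMonoOn (fun c => U c k) (Set.Ioi 0))
    (hu11 : ∀ c > (0:ℝ), ∀ k > (0:ℝ), pd11 u c k < 0)
    (hU11 : ∀ c > (0:ℝ), ∀ k > (0:ℝ), pd11 U c k < 0)
    (φ : ℝ → ℝ → ℝ)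
    (hφ : ∀ k > (0:ℝ), ∀ x > (0:ℝ), 0 < φ x k ∧ pd1 u (φ x k) k = x)
    (kinf : ℝ) (hkinf : 0 < kinf) (hfkinf : 0 < f kinf)
    (hu1pos : 0 < pd1 u (f kinf) kinf) (hU1pos : 0 < pd1 U (f kinf) kinf)
    (hbetween :
      (gunder0 f u U δ α kinf < deriv f kinf ∧ deriv f kinf < gbar0 f u δ kinf) ∨
      (gbar0 f u δ kinf < deriv f kinf ∧ deriv f kinf < gunder0 f u U δ α kinf)) :
    (gbar0 f u δ kinf < gunder0 f u U δ α kinf →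
      ∃ κ > (0:ℝ), ChiSol f u φ δ kinf (Set.Ioc (kinf - κ) kinf)) ∧
    (gunder0 f u U δ α kinf < gbar0 f u δ kinf →
      ∃ κ > (0:ℝ), ChiSol f u φ δ kinf (Set.Ico kinf (kinf + κ))) := by
  have hQ₀ : IsOpen (Ioi (0 : ℝ) ×ˢ Ioi (0 : ℝ)) := isOpen_Ioi.prod isOpen_Ioi
  have hu1 := contDiffOn_pd1 hQ₀ hu_smooth
  set Q : Set (ℝ × ℝ) := (Ioi 0 ×ˢ Ioi 0) ∩ (fun p => pd1 u p.1 p.2) ⁻¹' Ioi 0 with hQdef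
  have hQ : IsOpen Q := hu1.continuousOn.isOpen_inter_preimage hQ₀ isOpen_Ioi
  have hQsub : Q ⊆ Ioi 0 ×ˢ Ioi 0 := inter_subset_left
  have huQ := hu_smooth.mono hQsub
  have hPQ := hu1.mono hQsub
  have hHQ : ContDiffOn ℝ (⊤ : ℕ∞)
      (fun p : ℝ × ℝ => consumptionHamiltonian f u p.1 p.2) Q :=
    (((hf_smooth.comp contDiffOn_snd fun p hp => (hQsub hp).2).sub contDiffOn_fst).mul hPQ).add huQ
  have hdu : ∀ p ∈ Q, DifferentiableAt ℝ (fun p : ℝ × ℝ => u p.1 p.2) p := fun p hp =>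
    (huQ.contDiffAt (hQ.mem_nhds hp)).differentiableAt (by simp)
  have hdP : ∀ p ∈ Q, DifferentiableAt ℝ (fun p : ℝ × ℝ => pd1 u p.1 p.2) p := fun p hp =>
    (hPQ.contDiffAt (hQ.mem_nhds hp)).differentiableAt (by simp)
  have h₀ : (f kinf, kinf) ∈ Q := ⟨⟨hfkinf, hkinf⟩, hu1pos⟩
  have hdf : DifferentiableAt ℝ f kinf :=
    (hf_smooth.contDiffAt (isOpen_Ioi.mem_nhds hkinf)).differentiableAt (by simp)
  obtain ⟨ε, hε, c, k, hc0, hk0, hc1, hk1, hchar⟩ := exists_characteristic hQ hHQ hPQ δ h₀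
  have hkd : ∀ s ∈ Ioo (-ε) ε, deriv k s = (f (k s) - c s) * pd11 u (c s) (k s) := by
    intro s hs
    obtain ⟨hm, -, h, -⟩ := hchar s hs
    rw [h.deriv, pd1_consumptionHamiltonian f (hdu _ hm) (hdP _ hm)]
  have hq1 : ContDiffOn ℝ 1 (fun s => pd1 u (c s) (k s)) (Ioo (-ε) ε) :=
    (hPQ.of_le (by exact_mod_cast le_top)).comp (hc1.prodMk hk1) fun s hs => (hchar s hs).1
  have hφ' : ∀ s ∈ Ioo (-ε) ε, φ (pd1 u (c s) (k s)) (k s) = c s := by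
    intro s hs
    obtain ⟨⟨⟨hcs, hks⟩, hps⟩, -⟩ := hchar s hs
    obtain ⟨h1, h2⟩ := hφ (k s) hks _ hps
    exact eq_of_pd1_eq (fun c hc => hu11 c hc _ hks) h1 hcs h2
  have hW : ∀ s ∈ Ioo (-ε) ε, HasDerivAt
      (fun s => (f (k s) - c s) * pd1 u (c s) (k s) + u (c s) (k s))
      (δ * (pd1 u (c s) (k s) * deriv k s)) s := by
    intro s hs
    obtain ⟨-, -, h, h'⟩ := hchar s hs
    rw [h.deriv]
    exact h'
  have h0mem : (0 : ℝ) ∈ Ioo (-ε) ε := ⟨neg_lt_zero.2 hε, hε⟩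
  have hm : HasDerivAt (fun s => f (k s) - c s)
      (pd1 u (f kinf) kinf * (deriv f kinf - gbar0 f u δ kinf)) 0 := by
    obtain ⟨-, h1, -, -⟩ := hchar 0 h0mem
    have hk := ((hk1.differentiableOn one_ne_zero).differentiableAt
      (isOpen_Ioo.mem_nhds h0mem)).hasDerivAt
    rw [hkd 0 h0mem, hk0, hc0, sub_self, zero_mul] at hk
    rw [hk0, hc0, pd2_consumptionHamiltonian hdf (hdu _ h₀) (hdP _ h₀)] at h1
    rw [← hk0] at hdf
    refine ((hdf.hasDerivAt.comp 0 hk).sub h1).congr_deriv ?_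
    rw [gbar0]
    field_simp
    ring
  have hm0 : f (k 0) - c 0 = 0 := by rw [hk0, hc0, sub_self]
  have hfJ : ∀ J : Set ℝ, (∀ x ∈ J, 0 < x) → ContinuousOn f J := fun J hJ =>
    hf_cont.mono fun x hx => (hJ x hx).le
  constructor
  · intro hlt
    have hfg : gbar0 f u δ kinf < deriv f kinf := by
      rcases hbetween with h | h
      · exact absurd (h.1.trans h.2) hlt.le.not_gt
      · exact h.1
    obtain ⟨ε', hε', hpos⟩ := eventually_pos_right_of_hasDerivAt hm hm0
      (mul_pos hu1pos (sub_pos.2 hfg))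
    set η := min ε ε' with hη
    have hη0 : 0 < η := lt_min hε hε'
    have hsub : Ioo (-η) η ⊆ Ioo (-ε) ε :=
      Ioo_subset_Ioo (neg_le_neg (min_le_left _ _)) (min_le_left _ _)
    have hsub0 : Ioo 0 η ⊆ Ioo (-ε) ε :=
      Ioo_subset_Ioo (by linarith) (min_le_left _ _)
    have hsgn : ∀ s ∈ Ioo 0 η, 0 < f (k s) - c s := fun s hs =>
      hpos s ⟨hs.1, hs.2.trans_le (min_le_right _ _)⟩
    have hkneg : ∀ s ∈ Ioo 0 η, deriv k s < 0 := by
      intro s hs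
      obtain ⟨⟨⟨hcs, hks⟩, -⟩, -⟩ := hchar s (hsub0 hs)
      rw [hkd s (hsub0 hs)]
      exact mul_neg_of_pos_of_neg (hsgn s hs) (hu11 _ hcs _ hks)
    obtain ⟨κ, hκ, S, hS0, hS, hSc, hS1, hSd⟩ :=
      exists_left_inverse_branch hη0 (hk1.mono hsub) hkneg
    rw [hk0] at hS0 hS hSc hS1 hSd
    have hJpos : ∀ x ∈ Ioc (kinf - κ) kinf, 0 < x := by
      intro x hx
      obtain ⟨h1, h2⟩ := hS x hx
      rw [← h2]
      exact (hchar (S x) ⟨by linarith [h1.1], h1.2.trans_le (min_le_left _ _)⟩).1.1.2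
    exact ⟨κ, hκ, chiSol_of_branch hδ.ne' hκ hη0 (hfJ _ hJpos) (hc1.mono hsub)
      (hq1.mono hsub) (fun s hs => hφ' s (hsub hs)) hc0 (fun s hs => hW s (hsub hs))
      (fun s hs => (hkneg s hs).ne) hS0 hS hSc (by rwa [interior_Ioc])
      (by rwa [interior_Ioc]) (Or.inr ⟨rfl, hsgn⟩)⟩
  · intro hlt
    have hfg : deriv f kinf < gbar0 f u δ kinf := by
      rcases hbetween with h | h
      · exact h.2
      · exact absurd (h.1.trans h.2) hlt.le.not_gt
    obtain ⟨ε', hε', hpos⟩ := eventually_pos_right_of_hasDerivAt hm.fun_neg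
      (by rw [hm0, neg_zero]) (neg_pos.2 (mul_neg_of_pos_of_neg hu1pos (sub_neg.2 hfg)))
    set η := min ε ε' with hη
    have hη0 : 0 < η := lt_min hε hε'
    have hsub : Ioo (-η) η ⊆ Ioo (-ε) ε :=
      Ioo_subset_Ioo (neg_le_neg (min_le_left _ _)) (min_le_left _ _)
    have hsub0 : Ioo 0 η ⊆ Ioo (-ε) ε :=
      Ioo_subset_Ioo (by linarith) (min_le_left _ _)
    have hsgn : ∀ s ∈ Ioo 0 η, f (k s) - c s < 0 := fun s hs =>
      neg_pos.1 (hpos s ⟨hs.1, hs.2.trans_le (min_le_right _ _)⟩)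
    have hkpos : ∀ s ∈ Ioo 0 η, 0 < deriv k s := by
      intro s hs
      obtain ⟨⟨⟨hcs, hks⟩, -⟩, -⟩ := hchar s (hsub0 hs)
      rw [hkd s (hsub0 hs)]
      exact mul_pos_of_neg_of_neg (hsgn s hs) (hu11 _ hcs _ hks)
    obtain ⟨κ, hκ, S, hS0, hS, hSc, hS1, hSd⟩ :=
      exists_right_inverse_branch hη0 (hk1.mono hsub) hkpos
    rw [hk0] at hS0 hS hSc hS1 hSd
    exact ⟨κ, hκ, chiSol_of_branch hδ.ne' hκ hη0
      (hfJ _ fun x hx => hkinf.trans_le hx.1) (hc1.mono hsub)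
      (hq1.mono hsub) (fun s hs => hφ' s (hsub hs)) hc0 (fun s hs => hW s (hsub hs))
      (fun s hs => (hkpos s hs).ne') hS0 hS hSc (by rwa [interior_Ico])
      (by rwa [interior_Ico]) (Or.inl ⟨rfl, hsgn⟩)⟩
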